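/- arXiv:2105.15016 — 3 statements merged into one kernel-verified Lean document; each statement's English description precedes it below -/
import Mathlib

section
/- Let ε > 1 be real and set C(ε) = max{4, (6ε − 5)/2}. Then for all real numbers a > 0, b > 0, τ₁ ≥ 0, τ₂ ≥ 0 one has (b − a)·(τ₁^{ε+1} a^{−ε} − τ₂^{ε+1} b^{−ε}) ≥ (τ₁ τ₂/(ε − 1))·(τ₂^{(ε−1)/2} b^{(1−ε)/2} − τ₁^{(ε−1)/2} a^{(1−ε)/2})² − C(ε)·(τ₂ − τ₁)²·(τ₂^{ε−1} b^{1−ε} + τ₁^{ε−1} a^{1−ε}). -/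
lemma aux_bern (α u v : ℝ) (hα : 0 < α) (hu : 0 < u) (hv : 0 < v) :
    u * (u ^ (-α) - v ^ (-α)) ≤ α * (v - u) * u ^ (-α) := by
  have hU : 0 < u ^ (-α) := Real.rpow_pos_of_pos hu _
  have e : v ^ (-α) = u ^ (-α) * (v / u) ^ (-α) := by
    rw [← Real.mul_rpow hu.le (by positivity)]
    congr 1
    field_simp
  have h1 : 1 - α * (v / u - 1) ≤ (v / u) ^ (-α) := by
    rw [Real.rpow_def_of_pos (by positivity)]
    have h2 := Real.add_one_le_exp (Real.log (v / u) * -α)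
    have h3 := Real.log_le_sub_one_of_pos (show 0 < v / u by positivity)
    nlinarith
  have h4 : v = u * (v / u) := by field_simp
  have h5 := mul_le_mul_of_nonneg_left h1 (mul_pos hu hU).le
  rw [e]
  generalize (v / u) ^ (-α) = W at *
  generalize u ^ (-α) = U at *
  generalize v / u = s at *
  subst h4
  nlinarith

lemma aux_key_le (α u v : ℝ) (hα : 0 < α) (hu : 0 < u) (huv : u ≤ v) :
    (v ^ (-α) - u ^ (-α)) ^ 2 ≤
      α * ((v - u) * ((u ^ (-α)) ^ 2 / u - (v ^ (-α)) ^ 2 / v)) := by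
  have hv : 0 < v := hu.trans_le huv
  have hb := aux_bern α u v hα hu hv
  have hm : v ^ (-α) ≤ u ^ (-α) := Real.rpow_le_rpow_of_nonpos hu huv (by linarith)
  have hV : 0 < v ^ (-α) := Real.rpow_pos_of_pos hv _
  generalize v ^ (-α) = V at *
  generalize u ^ (-α) = U at *
  have h1 : V ^ 2 / v ≤ U * V / u := by
    apply div_le_div₀ <;> nlinarith
  have h2 : (V - U) ^ 2 ≤ α * ((v - u) * (U ^ 2 / u - U * V / u)) := by
    have : α * ((v - u) * (U ^ 2 / u - U * V / u)) = (α * (v - u) * U) * (U - V) / u := by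
      field_simp
    rw [this, le_div_iff₀ hu]
    nlinarith [mul_le_mul_of_nonneg_right hb (sub_nonneg.2 hm)]
  refine h2.trans ?_
  have : 0 ≤ v - u := by linarith
  gcongr

lemma aux_key (α u v : ℝ) (hα : 0 < α) (hu : 0 < u) (hv : 0 < v) :
    (v ^ (-α) - u ^ (-α)) ^ 2 ≤
      α * ((v - u) * ((u ^ (-α)) ^ 2 / u - (v ^ (-α)) ^ 2 / v)) := by
  rcases le_total u v with h | h
  · exact aux_key_le α u v hα hu h
  · have := aux_key_le α v u hα hv h
    linarith

lemma aux_poly (K D s t p q : ℝ) (hs : 0 < s) (ht : 0 < t) (hD : 7 / 2 ≤ D) (hK : 3 ≤ D * K) :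
    (t - s) * (t + s) * (p - q) * (p + q) / 2 ≤
      s * t * K * (p - q) ^ 2 + D * (t - s) ^ 2 * (p ^ 2 + q ^ 2) := by
  have hD0 : 0 < D := by linarith
  refine le_of_mul_le_mul_left ?_ hD0
  have h1 : 0 ≤ (D * K - 3) * (s * t * (p - q) ^ 2) :=
    mul_nonneg (by linarith) (by positivity)
  have h2 : 0 ≤ (D ^ 2 - 1) * ((t - s) ^ 2 * (p - q) ^ 2) :=
    mul_nonneg (by nlinarith) (by positivity)
  have h3 : 0 ≤ s * t * (p - q) ^ 2 := by positivity
  have h4 : 0 ≤ ((t - s) * (p - q)) ^ 2 := by positivity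
  nlinarith [sq_nonneg (D * (p + q) * (t - s) - (t + s) * (p - q) / 2)]

lemma aux_sub (ε τ u : ℝ) (hτ : 0 < τ) (hu : 0 < u) :
    τ ^ ((ε - 1) / 2) * (τ * u) ^ ((1 - ε) / 2) = u ^ (-((ε - 1) / 2)) ∧
    τ ^ (ε - 1) * (τ * u) ^ (1 - ε) = (u ^ (-((ε - 1) / 2))) ^ 2 ∧
    τ ^ (ε + 1) * (τ * u) ^ (-ε) = τ * ((u ^ (-((ε - 1) / 2))) ^ 2 / u) := by
  refine ⟨?_, ?_, ?_⟩
  · rw [Real.mul_rpow hτ.le hu.le, ← mul_assoc, ← Real.rpow_add hτ]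
    ring_nf
    simp
  · rw [Real.mul_rpow hτ.le hu.le, ← mul_assoc, ← Real.rpow_add hτ, ← Real.rpow_natCast,
      ← Real.rpow_mul hu.le]
    ring_nf
    simp
  · rw [Real.mul_rpow hτ.le hu.le, ← mul_assoc, ← Real.rpow_add hτ, ← Real.rpow_natCast,
      ← Real.rpow_mul hu.le, ← Real.rpow_sub_one hu.ne']
    have e1 : ε + 1 + -ε = 1 := by ring
    have e2 : -((ε - 1) / 2) * ((2 : ℕ) : ℝ) - 1 = -ε := by push_cast; ring
    rw [e1, e2, Real.rpow_one]

lemma aux_zero (ε C a b τ : ℝ) (hC : 4 ≤ C) (ha : 0 < a) (hb : 0 < b) (hτ : 0 ≤ τ) (hε : 1 < ε) :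
    (b - a) * (τ ^ (ε + 1) * b ^ (-ε)) ≤ C * τ ^ 2 * (τ ^ (ε - 1) * b ^ (1 - ε)) := by
  have e1 : τ ^ (ε + 1) = τ ^ 2 * τ ^ (ε - 1) := by
    rcases hτ.eq_or_lt with rfl | h
    · rw [Real.zero_rpow (by linarith)]; simp
    · rw [← Real.rpow_natCast, ← Real.rpow_add h]; congr 1; push_cast; ring
  have e2 : b ^ (1 - ε) = b * b ^ (-ε) := by
    rw [sub_eq_add_neg, Real.rpow_add hb, Real.rpow_one]
  rw [e1, e2]
  have h : 0 ≤ τ ^ 2 * τ ^ (ε - 1) * b ^ (-ε) := by positivity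
  have h2 : 0 ≤ (C * b - (b - a)) * (τ ^ 2 * τ ^ (ε - 1) * b ^ (-ε)) :=
    mul_nonneg (by nlinarith) h
  nlinarith

theorem stmt_0 (ε : ℝ) (hε : 1 < ε) (a b τ₁ τ₂ : ℝ)
    (ha : 0 < a) (hb : 0 < b) (hτ₁ : 0 ≤ τ₁) (hτ₂ : 0 ≤ τ₂) :
    (τ₁ * τ₂ / (ε - 1)) *
        (τ₂ ^ ((ε - 1) / 2) * b ^ ((1 - ε) / 2) - τ₁ ^ ((ε - 1) / 2) * a ^ ((1 - ε) / 2)) ^ 2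
      - max 4 ((6 * ε - 5) / 2) * (τ₂ - τ₁) ^ 2 *
        (τ₂ ^ (ε - 1) * b ^ (1 - ε) + τ₁ ^ (ε - 1) * a ^ (1 - ε))
      ≤ (b - a) * (τ₁ ^ (ε + 1) * a ^ (-ε) - τ₂ ^ (ε + 1) * b ^ (-ε)) := by
  have hC4 : 4 ≤ max 4 ((6 * ε - 5) / 2) := le_max_left _ _
  have hC : (6 * ε - 5) / 2 ≤ max 4 ((6 * ε - 5) / 2) := le_max_right _ _
  generalize max 4 ((6 * ε - 5) / 2) = C at *
  rcases hτ₁.eq_or_lt with rfl | h₁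
  · have := aux_zero ε C a b τ₂ hC4 ha hb hτ₂ hε
    rw [Real.zero_rpow (show ε - 1 ≠ 0 by linarith), Real.zero_rpow (show ε + 1 ≠ 0 by linarith)]
    simp only [zero_mul, zero_div, sub_zero, add_zero]
    linarith
  rcases hτ₂.eq_or_lt with rfl | h₂
  · have := aux_zero ε C b a τ₁ hC4 hb ha hτ₁ hε
    rw [Real.zero_rpow (show ε - 1 ≠ 0 by linarith), Real.zero_rpow (show ε + 1 ≠ 0 by linarith)]
    simp only [zero_mul, mul_zero, zero_div, zero_sub, zero_add, sub_zero, neg_sq]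
    linarith
  obtain ⟨u, hu, rfl⟩ : ∃ u, 0 < u ∧ a = τ₁ * u := ⟨a / τ₁, by positivity, by field_simp⟩
  obtain ⟨v, hv, rfl⟩ : ∃ v, 0 < v ∧ b = τ₂ * v := ⟨b / τ₂, by positivity, by field_simp⟩
  obtain ⟨a1, a2, a3⟩ := aux_sub ε τ₁ u h₁ hu
  obtain ⟨b1, b2, b3⟩ := aux_sub ε τ₂ v h₂ hv
  rw [a1, a2, a3, b1, b2, b3]
  have hr : 0 < ε - 1 := by linarith
  have key := aux_key ((ε - 1) / 2) u v (by linarith) hu hv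
  generalize u ^ (-((ε - 1) / 2)) = q at *
  generalize v ^ (-((ε - 1) / 2)) = p at *
  have hK : 3 ≤ (C - 1 / 2) * (1 / (ε - 1)) := by
    rw [mul_one_div, le_div_iff₀ hr]; linarith
  have poly := aux_poly (1 / (ε - 1)) (C - 1 / 2) τ₁ τ₂ p q h₁ h₂ (by linarith) hK
  have key2 : 2 * (1 / (ε - 1)) * (p - q) ^ 2 ≤ (v - u) * (q ^ 2 / u - p ^ 2 / v) := by
    have : 2 * (1 / (ε - 1)) * (p - q) ^ 2 = (p - q) ^ 2 / ((ε - 1) / 2) := by field_simp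
    rw [this, div_le_iff₀ (by linarith)]
    linarith
  have key3 := mul_le_mul_of_nonneg_left key2 (mul_pos h₁ h₂).le
  have eR : (τ₂ * v - τ₁ * u) * (τ₁ * (q ^ 2 / u) - τ₂ * (p ^ 2 / v)) =
      τ₁ * τ₂ * ((v - u) * (q ^ 2 / u - p ^ 2 / v)) - (τ₂ - τ₁) * (τ₂ * p ^ 2 - τ₁ * q ^ 2) := by
    field_simp
    ring
  rw [eR, div_eq_mul_one_div]
  generalize 1 / (ε - 1) = K at *
  generalize (v - u) * (q ^ 2 / u - p ^ 2 / v) = M at *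
  linarith
end

section
/- Let ε ∈ (0,1) be real and set ζ(ε) = 4ε/(1−ε), ζ₁(ε) = ζ(ε)/6 and ζ₂(ε) = ζ(ε) + 9/ε. Then for all real numbers a > 0, b > 0, τ₁ ≥ 0, τ₂ ≥ 0 one has (b − a)·(τ₁² a^{−ε} − τ₂² b^{−ε}) ≥ ζ₁(ε)·(τ₂ b^{(1−ε)/2} − τ₁ a^{(1−ε)/2})² − ζ₂(ε)·(τ₂ − τ₁)²·(b^{1−ε} + a^{1−ε}). -/
set_option maxHeartbeats 2000000 in
theorem core_aux (ε u p y s t : ℝ) (h0 : 0 < ε) (h1 : ε < 1) (hu : 1 ≤ u) (hp0 : 0 < p)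
    (hp1 : p ≤ 1) (hy : 1 ≤ y) (hyp : y ^ 2 = u ^ 2 * p)
    (hb : y - 1 ≤ (1 - ε) * (u - 1)) (hp : u ^ 2 * p ≤ u ^ 2 - ε * (u ^ 2 - 1)) :
    (4 * ε / (1 - ε) / 6) * (t * y - s) ^ 2
      - (4 * ε / (1 - ε) + 9 / ε) * (t - s) ^ 2 * (y ^ 2 + 1)
      ≤ (u ^ 2 - 1) * (s ^ 2 - t ^ 2 * p) := by
  have h1' : 0 < 1 - ε := by linarith
  have hu2 : 0 ≤ u ^ 2 - 1 := by nlinarith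
  obtain ⟨z, hz⟩ : ∃ z, z = 4 * ε / (1 - ε) := ⟨_, rfl⟩
  have hz' : z * (1 - ε) = 4 * ε := by rw [hz]; field_simp
  have hz0 : 0 ≤ z := by rw [hz]; positivity
  obtain ⟨k, hk⟩ : ∃ k, k = 1 / ε := ⟨_, rfl⟩
  have hk' : k * ε = 1 := by rw [hk]; field_simp
  have hk1 : 1 ≤ k := by rw [hk, le_div_iff₀ h0]; linarith
  have hk9 : 9 / ε = 9 * k := by rw [hk]; ring
  rw [hk9, ← hz]
  obtain ⟨R, hR⟩ : ∃ R, R = (u ^ 2 - 1) * (1 - p) := ⟨_, rfl⟩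
  have hR0 : 0 ≤ R := by rw [hR]; exact mul_nonneg hu2 (by linarith)
  have hyu : y - 1 ≤ u - 1 := by nlinarith
  -- (1)
  have e1 : z * (y - 1) ^ 2 ≤ 4 * R := by
    have a1 : z * (y - 1) ^ 2 ≤ 4 * ε * ((u - 1) * (y - 1)) := by
      have : z * (y - 1) * (y - 1) ≤ z * (y - 1) * ((1 - ε) * (u - 1)) :=
        mul_le_mul_of_nonneg_left hb (mul_nonneg hz0 (by linarith))
      calc _ = z * (y - 1) * (y - 1) := by ring
        _ ≤ _ := this
        _ = z * (1 - ε) * ((u - 1) * (y - 1)) := by ring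
        _ = _ := by rw [hz']
    have a2 : ε * (u - 1) ≤ (u + 1) * (1 - p) := by
      have : u ^ 2 * (ε * (u - 1)) ≤ u ^ 2 * ((u + 1) * (1 - p)) := by
        have b1 : (u + 1) * (ε * (u ^ 2 - 1)) ≤ (u + 1) * (u ^ 2 * (1 - p)) :=
          mul_le_mul_of_nonneg_left (by linarith) (by linarith)
        have b2 : 0 ≤ ε * (u - 1) * (2 * u + 1) :=
          mul_nonneg (mul_nonneg h0.le (by linarith)) (by linarith)
        nlinarith
      exact le_of_mul_le_mul_left this (by positivity)
    have a3 : (u - 1) * (ε * (y - 1)) ≤ (u - 1) * ((u + 1) * (1 - p)) :=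
      mul_le_mul_of_nonneg_left
        (le_trans (mul_le_mul_of_nonneg_left hyu h0.le) a2) (by linarith)
    rw [hR]; nlinarith
  obtain ⟨c, hc⟩ : ∃ c, c = (u ^ 2 - 1) * p := ⟨_, rfl⟩
  have hc0 : 0 ≤ c := by rw [hc]; exact mul_nonneg hu2 hp0.le
  have hcy : c ≤ y ^ 2 := by rw [hc, hyp]; nlinarith
  have e2 : c ^ 2 ≤ R * (k * y ^ 2) := by
    have a1 : u ^ 2 - 1 ≤ k * (u ^ 2 * (1 - p)) := by
      have : k * (ε * (u ^ 2 - 1)) ≤ k * (u ^ 2 * (1 - p)) :=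
        mul_le_mul_of_nonneg_left (by linarith) (by linarith)
      rwa [← mul_assoc, hk', one_mul] at this
    have a2 : c * p ≤ c := by nlinarith
    have a3 : (u ^ 2 - 1) * p * (u ^ 2 - 1) ≤ (u ^ 2 - 1) * p * (k * (u ^ 2 * (1 - p))) :=
      mul_le_mul_of_nonneg_left a1 (hc ▸ hc0)
    have a4 : c ^ 2 ≤ (u ^ 2 - 1) * p * (u ^ 2 - 1) := by
      have := mul_le_mul_of_nonneg_right a2 hu2
      calc c ^ 2 = c * p * (u ^ 2 - 1) := by rw [hc]; ring
        _ ≤ c * (u ^ 2 - 1) := this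
        _ = _ := by rw [hc]
    calc c ^ 2 ≤ _ := a4
      _ ≤ _ := a3
      _ = _ := by rw [hR, hyp]; ring
  obtain ⟨d, hd⟩ : ∃ d, d = t - s := ⟨_, rfl⟩
  have ht : t = s + d := by rw [hd]; ring
  have hky : y ^ 2 ≤ k * y ^ 2 := by nlinarith [sq_nonneg y]
  have e3 : 2 * s * d * c ≤ s ^ 2 * R / 6 + 6 * (d ^ 2 * (k * y ^ 2)) := by
    have hK : 0 ≤ k * y ^ 2 := by positivity
    apply le_of_abs_le
    apply abs_le_of_sq_le_sq
    · have : s ^ 2 * d ^ 2 * c ^ 2 ≤ s ^ 2 * d ^ 2 * (R * (k * y ^ 2)) :=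
        mul_le_mul_of_nonneg_left e2 (by positivity)
      nlinarith [sq_nonneg (s ^ 2 * R / 6 - 6 * (d ^ 2 * (k * y ^ 2)))]
    · positivity
  have e4 : d ^ 2 * c ≤ d ^ 2 * (k * y ^ 2) :=
    mul_le_mul_of_nonneg_left (hcy.trans hky) (sq_nonneg d)
  have e5 : z * (t * y - s) ^ 2 ≤ 5 / 4 * (s ^ 2 * (z * (y - 1) ^ 2)) + 5 * (z * (d ^ 2 * y ^ 2)) := by
    have : 0 ≤ z * (s * (y - 1) / 2 - 2 * (d * y)) ^ 2 := by positivity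
    rw [ht]; nlinarith
  have e6 : s ^ 2 * (z * (y - 1) ^ 2) ≤ s ^ 2 * (4 * R) :=
    mul_le_mul_of_nonneg_left e1 (sq_nonneg s)
  have e7 : (u ^ 2 - 1) * (s ^ 2 - t ^ 2 * p) = s ^ 2 * R - 2 * s * d * c - d ^ 2 * c := by
    rw [ht, hR, hc]; ring
  rw [e7, ← hd]
  have p1 : 0 ≤ z * (d ^ 2 * y ^ 2) := by positivity
  have p2 : 0 ≤ d ^ 2 * (k * y ^ 2) := by positivity
  have p3 : 0 ≤ z * d ^ 2 := by positivity
  have p4 : 0 ≤ k * d ^ 2 := by positivity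
  nlinarith

theorem half_aux (ε : ℝ) (hε : ε ∈ Set.Ioo (0 : ℝ) 1) (a b τ₁ τ₂ : ℝ)
    (ha : 0 < a) (hb : 0 < b) (hab : a ≤ b) :
    (4 * ε / (1 - ε) / 6) * (τ₂ * b ^ ((1 - ε) / 2) - τ₁ * a ^ ((1 - ε) / 2)) ^ 2
      - (4 * ε / (1 - ε) + 9 / ε) * (τ₂ - τ₁) ^ 2 * (b ^ (1 - ε) + a ^ (1 - ε))
      ≤ (b - a) * (τ₁ ^ 2 * a ^ (-ε) - τ₂ ^ 2 * b ^ (-ε)) := by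
  obtain ⟨h0, h1⟩ := hε
  obtain ⟨u, hu⟩ : ∃ u, u = Real.sqrt (b / a) := ⟨_, rfl⟩
  have hu1 : 1 ≤ u := by
    rw [hu, Real.one_le_sqrt, le_div_iff₀ ha]; linarith
  have hu0 : 0 < u := by linarith
  have hbu : b = u ^ 2 * a := by
    rw [hu, Real.sq_sqrt (by positivity)]; field_simp
  have hsq : ∀ x : ℝ, 0 < x → ∀ r : ℝ, (x ^ 2) ^ r = (x ^ r) ^ 2 := by
    intro x hx r
    rw [sq, sq, Real.mul_rpow hx.le hx.le]
  have hm : ∀ x : ℝ, 0 < x → x ^ (1 - ε) = (x ^ ((1 - ε) / 2)) ^ 2 := by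
    intro x hx
    rw [← Real.rpow_natCast, ← Real.rpow_mul hx.le]; congr 1; push_cast; ring
  have hae : a ^ (1 - ε) = a * a ^ (-ε) := by
    rw [sub_eq_add_neg, Real.rpow_add ha, Real.rpow_one]
  have hy2 : (u ^ 2) ^ ((1 - ε) / 2) = u ^ (1 - ε) := by
    rw [hsq u hu0, ← hm u hu0]
  have key := core_aux ε u ((u ^ 2) ^ (-ε)) (u ^ (1 - ε)) τ₁ τ₂ h0 h1 hu1 (by positivity)
    (Real.rpow_le_one_of_one_le_of_nonpos (by nlinarith) (by linarith))
    (Real.one_le_rpow hu1 (by linarith))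
    (by rw [hsq u hu0, sub_eq_add_neg, Real.rpow_add hu0, Real.rpow_one]; ring)
    (by
      have := rpow_one_add_le_one_add_mul_self (s := u - 1) (by linarith)
        (p := 1 - ε) (by linarith) (by linarith)
      rw [add_sub_cancel] at this; linarith)
    (by
      have := rpow_one_add_le_one_add_mul_self (s := (u ^ 2)⁻¹ - 1)
        (by have : 0 < (u ^ 2)⁻¹ := by positivity
            linarith)
        (p := ε) (by linarith) (by linarith)
      rw [add_sub_cancel, Real.inv_rpow (by positivity), ← Real.rpow_neg (by positivity)] at this
      have h := mul_le_mul_of_nonneg_left this (sq_nonneg u)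
      have e : u ^ 2 * (1 + ε * ((u ^ 2)⁻¹ - 1)) = u ^ 2 - ε * (u ^ 2 - 1) := by
        field_simp
        ring
      linarith)
  have hM : 0 ≤ a ^ (1 - ε) := by positivity
  have := mul_le_mul_of_nonneg_left key hM
  have b1 : b ^ ((1 - ε) / 2) = u ^ (1 - ε) * a ^ ((1 - ε) / 2) := by
    rw [hbu, Real.mul_rpow (by positivity) ha.le, hy2]
  have b2 : b ^ (-ε) = (u ^ 2) ^ (-ε) * a ^ (-ε) := by
    rw [hbu, Real.mul_rpow (by positivity) ha.le]
  rw [hm b hb, b1, b2]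
  refine le_trans (le_of_eq ?_) (this.trans (le_of_eq ?_))
  · rw [hm a ha]; ring
  · rw [hae, hbu]; ring

theorem stmt_1 (ε : ℝ) (hε : ε ∈ Set.Ioo (0 : ℝ) 1) (a b τ₁ τ₂ : ℝ)
    (ha : 0 < a) (hb : 0 < b) (hτ₁ : 0 ≤ τ₁) (hτ₂ : 0 ≤ τ₂) :
    (4 * ε / (1 - ε) / 6) * (τ₂ * b ^ ((1 - ε) / 2) - τ₁ * a ^ ((1 - ε) / 2)) ^ 2
      - (4 * ε / (1 - ε) + 9 / ε) * (τ₂ - τ₁) ^ 2 * (b ^ (1 - ε) + a ^ (1 - ε))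
      ≤ (b - a) * (τ₁ ^ 2 * a ^ (-ε) - τ₂ ^ 2 * b ^ (-ε)) := by
  rcases le_total a b with h | h
  · exact half_aux ε hε a b τ₁ τ₂ ha hb h
  · have := half_aux ε hε b a τ₂ τ₁ hb ha h
    refine le_trans (le_of_eq ?_) (this.trans (le_of_eq ?_)) <;> ring
end

section
/- Let N ≥ 2, x₀ ∈ ℝ^N, r > 0, let g : [0, ∞) → [0, ∞) be a nonincreasing bounded function, and define the radially decreasing weight φ(x) = g(|x − x₀|) for x ∈ B_r(x₀); assume ∫_{B_r(x₀)} φ(x) dx > 0. Then there exists a constant C > 0, depending only on N and on the weight φ (equivalently, on the rescaled profile t ↦ g(rt)), such that for every continuously differentiable function u : B_r(x₀) → ℝ with ∫_{B_r(x₀)} (u(x)² + |∇u(x)|²) φ(x) dx < ∞ one has ∫_{B_r(x₀)} |u(x) − u_φ|² φ(x) dx ≤ C r² ∫_{B_r(x₀)} |∇u(x)|² φ(x) dx, where u_φ = ( ∫_{B_r(x₀)} u(x) φ(x) dx ) / ( ∫_{B_r(x₀)} φ(x) dx ). -/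
open MeasureTheory
noncomputable section

theorem aux_ftc {N : ℕ} (x₀ : EuclideanSpace ℝ (Fin N)) (r : ℝ)
    (u : EuclideanSpace ℝ (Fin N) → ℝ) (hu : ContDiffOn ℝ 1 u (Metric.ball x₀ r))
    (x y : EuclideanSpace ℝ (Fin N)) (hx : x ∈ Metric.ball x₀ r) (hy : y ∈ Metric.ball x₀ r) :
    IntervalIntegrable (fun t : ℝ => ‖gradient u ((1-t) • x + t • y)‖^2) volume 0 1 ∧
    (u x - u y)^2 ≤ ‖y - x‖^2 * ∫ t in (0:ℝ)..1, ‖gradient u ((1-t) • x + t • y)‖^2 := by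
  set z : ℝ → EuclideanSpace ℝ (Fin N) := fun t => (1-t) • x + t • y with hz
  have hzB : ∀ t ∈ Set.uIcc (0:ℝ) 1, z t ∈ Metric.ball x₀ r := by
    intro t ht
    rw [Set.uIcc_of_le zero_le_one] at ht
    exact (convex_ball x₀ r) hx hy (by linarith [ht.2]) ht.1 (by ring)
  have hzc : Continuous z := by fun_prop
  have hzd : ∀ t, HasDerivAt z (y - x) t := by
    intro t
    have h1 : HasDerivAt (fun t : ℝ => (1-t) • x) ((-1:ℝ) • x) t :=
      ((hasDerivAt_id t).const_sub 1).smul_const x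
    have h2 : HasDerivAt (fun t : ℝ => t • y) ((1:ℝ) • y) t :=
      (hasDerivAt_id t).smul_const y
    have := h1.add h2
    rw [show y - x = (-1:ℝ) • x + (1:ℝ) • y by module]
    exact this
  have hfc : ContinuousOn (fderiv ℝ u) (Metric.ball x₀ r) :=
    hu.continuousOn_fderiv_of_isOpen Metric.isOpen_ball le_rfl
  have hfz : ContinuousOn (fun t => fderiv ℝ u (z t)) (Set.uIcc (0:ℝ) 1) :=
    hfc.comp hzc.continuousOn hzB
  have hgn : ∀ p, ‖gradient u p‖ = ‖fderiv ℝ u p‖ := by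
    intro p
    simp [gradient]
  have hI2 : IntervalIntegrable (fun t : ℝ => ‖gradient u (z t)‖^2) volume 0 1 := by
    simp only [hgn]
    exact (hfz.norm.pow 2).intervalIntegrable
  refine ⟨hI2, ?_⟩
  have hd : ∀ t ∈ Set.uIcc (0:ℝ) 1,
      HasDerivAt (fun t => u (z t)) (fderiv ℝ u (z t) (y - x)) t := by
    intro t ht
    have : HasFDerivAt u (fderiv ℝ u (z t)) (z t) :=
      ((hu.differentiableOn one_ne_zero).differentiableAt
        (Metric.isOpen_ball.mem_nhds (hzB t ht))).hasFDerivAt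
    exact this.comp_hasDerivAt t (hzd t)
  have hc : ContinuousOn (fun t => fderiv ℝ u (z t) (y - x)) (Set.uIcc (0:ℝ) 1) :=
    hfz.clm_apply continuousOn_const
  have hin : IntervalIntegrable (fun t => fderiv ℝ u (z t) (y - x)) volume 0 1 := hc.intervalIntegrable
  have hin2 : IntervalIntegrable (fun t => (fderiv ℝ u (z t) (y - x))^2) volume 0 1 :=
    (hc.pow 2).intervalIntegrable
  have key := intervalIntegral.integral_eq_sub_of_hasDerivAt hd hin
  set c := u y - u x with hcdef
  have e0 : z 0 = x := by simp [hz]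
  have e1 : z 1 = y := by simp [hz]
  simp only [e0, e1] at key
  have hpos : 0 ≤ ∫ t in (0:ℝ)..1, (fderiv ℝ u (z t) (y - x) - c)^2 :=
    intervalIntegral.integral_nonneg zero_le_one (fun t _ => sq_nonneg _)
  have hexp : ∫ t in (0:ℝ)..1, (fderiv ℝ u (z t) (y - x) - c)^2
      = (∫ t in (0:ℝ)..1, (fderiv ℝ u (z t) (y - x))^2) - c^2 := by
    have : ∀ t, (fderiv ℝ u (z t) (y - x) - c)^2 =
      (fderiv ℝ u (z t) (y - x))^2 - (2 * c * (fderiv ℝ u (z t) (y - x)) - c^2) := by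
      intro t; ring
    simp only [this]
    rw [intervalIntegral.integral_sub hin2 ((hin.const_mul _).sub intervalIntegrable_const),
      intervalIntegral.integral_sub (hin.const_mul _) intervalIntegrable_const,
      intervalIntegral.integral_const_mul, key]
    simp
    ring
  have hle : ∫ t in (0:ℝ)..1, (fderiv ℝ u (z t) (y - x))^2 ≤
      ∫ t in (0:ℝ)..1, ‖y - x‖^2 * ‖gradient u (z t)‖^2 := by
    refine intervalIntegral.integral_mono_on zero_le_one hin2 (hI2.const_mul _) ?_
    intro t _
    have := (fderiv ℝ u (z t)).le_opNorm (y - x)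
    rw [hgn, ← mul_pow, mul_comm, ← sq_abs]
    exact pow_le_pow_left₀ (abs_nonneg _) this 2
  rw [intervalIntegral.integral_const_mul] at hle
  have : (u x - u y)^2 = c^2 := by rw [hcdef]; ring
  rw [this]
  linarith

theorem aux_cov {N : ℕ} (K : EuclideanSpace ℝ (Fin N) → ENNReal) (hK : Measurable K)
    (a : ℝ) (ha : 1/2 ≤ a) (b : EuclideanSpace ℝ (Fin N)) :
    ∫⁻ x, K (a • x + b) ≤ 2^N * ∫⁻ x, K x := by
  have ha0 : a ≠ 0 := by linarith
  have h1 : ∫⁻ x, K (a • x + b) = ∫⁻ x, K (x + b) ∂(Measure.map (a • ·) volume) := by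
    rw [lintegral_map (by fun_prop) (by fun_prop)]
  rw [h1, Measure.map_addHaar_smul _ ha0, lintegral_smul_measure,
    lintegral_add_right_eq_self]
  simp only [finrank_euclideanSpace, Fintype.card_fin, smul_eq_mul]
  gcongr
  have : (2:ENNReal)^N = ENNReal.ofReal (2^N) := by
    rw [ENNReal.ofReal_pow (by norm_num)]; simp
  rw [this]
  apply ENNReal.ofReal_le_ofReal
  rw [abs_of_nonneg (by positivity), ← inv_pow]
  apply pow_le_pow_left₀ (by positivity)
  rw [inv_le_comm₀ (by linarith) (by norm_num)]
  linarith

theorem aux_double {N : ℕ} (K : EuclideanSpace ℝ (Fin N) → ENNReal) (hK : Measurable K)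
    (B : Set (EuclideanSpace ℝ (Fin N))) :
    ∫⁻ x in B, ∫⁻ y in B, ∫⁻ t in Set.Ioc (0:ℝ) 1, K ((1-t) • x + t • y) ≤
      2^N * volume B * ∫⁻ x, K x := by
  set Q := ∫⁻ x, K x with hQ
  have hmeas : Measurable (fun p : (EuclideanSpace ℝ (Fin N) × EuclideanSpace ℝ (Fin N)) × ℝ =>
      K ((1-p.2) • p.1.1 + p.2 • p.1.2)) := hK.comp (by fun_prop)
  have h1 : ∀ x, ∫⁻ y in B, ∫⁻ t in Set.Ioc (0:ℝ) 1, K ((1-t) • x + t • y)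
      = ∫⁻ t in Set.Ioc (0:ℝ) 1, ∫⁻ y in B, K ((1-t) • x + t • y) := by
    intro x
    apply lintegral_lintegral_swap
    apply Measurable.aemeasurable
    exact hK.comp (by fun_prop)
  simp_rw [h1]
  rw [lintegral_lintegral_swap]
  swap
  · apply Measurable.aemeasurable
    have : Measurable (fun p : (EuclideanSpace ℝ (Fin N) × ℝ) × EuclideanSpace ℝ (Fin N) =>
      K ((1-p.1.2) • p.1.1 + p.1.2 • p.2)) := hK.comp (by fun_prop)
    exact this.lintegral_prod_right'
  have h2 : ∀ t : ℝ, ∫⁻ x in B, ∫⁻ y in B, K ((1-t) • x + t • y) ≤ 2^N * volume B * Q := by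
    intro t
    have hb : ∫⁻ _ in B, 2^N * Q = 2^N * volume B * Q := by
      rw [setLIntegral_const]; ring
    rcases le_total t (1/2) with ht | ht
    · rw [lintegral_lintegral_swap, ← hb]
      · refine lintegral_mono fun y => ?_
        exact (setLIntegral_le_lintegral _ _).trans (aux_cov K hK (1-t) (by linarith) (t • y))
      · apply Measurable.aemeasurable
        exact hK.comp (by fun_prop)
    · rw [← hb]
      refine lintegral_mono fun x => ?_
      refine (setLIntegral_le_lintegral _ _).trans ?_
      simp_rw [add_comm ((1-t) • x)]
      exact aux_cov K hK t ht ((1-t) • x)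
  calc _ ≤ ∫⁻ t in Set.Ioc (0:ℝ) 1, 2^N * volume B * Q := lintegral_mono fun t => h2 t
    _ = _ := by rw [setLIntegral_const]; simp

theorem aux_var {α : Type*} [MeasurableSpace α] (μ : Measure α) (w u : α → ℝ)
    (hw : Integrable w μ) (huw : Integrable (fun x => u x * w x) μ)
    (huuw : Integrable (fun x => u x ^ 2 * w x) μ) (hw0 : ∀ x, 0 ≤ w x)
    (hpos : 0 < ∫ x, w x ∂μ) :
    ENNReal.ofReal (2 * (∫ x, w x ∂μ) *
      ∫ x, |u x - (∫ y, u y * w y ∂μ) / (∫ y, w y ∂μ)| ^ 2 * w x ∂μ) =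
    ∫⁻ x, ∫⁻ y, ENNReal.ofReal ((u x - u y)^2 * (w x * w y)) ∂μ ∂μ := by
  set P := ∫ x, w x ∂μ
  set A := ∫ x, u x * w x ∂μ with hA
  set D := ∫ x, u x ^ 2 * w x ∂μ with hD
  have hfi : ∀ c : ℝ, Integrable (fun y => (c - u y)^2 * w y) μ := by
    intro c
    have := ((hw.const_mul (c^2)).sub (huw.const_mul (2*c))).add huuw
    refine this.congr (Filter.Eventually.of_forall fun y => ?_)
    simp only [Pi.add_apply, Pi.sub_apply]
    ring
  have hfe : ∀ c : ℝ, ∫ y, (c - u y)^2 * w y ∂μ = c^2 * P - 2*c*A + D := by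
    intro c
    rw [hD, hA, ← integral_const_mul, ← integral_const_mul,
      ← integral_sub (hw.const_mul _) (huw.const_mul _),
      ← integral_add (f := fun a => c ^ 2 * w a - 2 * c * (u a * w a))
        ((hw.const_mul _).sub (huw.const_mul _)) huuw]
    congr 1; ext y; ring
  have e1 : ∀ x, ∫⁻ y, ENNReal.ofReal ((u x - u y)^2 * (w x * w y)) ∂μ
      = ENNReal.ofReal (w x * (u x^2 * P - 2*u x*A + D)) := by
    intro x
    rw [← hfe, ← integral_const_mul, ofReal_integral_eq_lintegral_ofReal]
    · congr 1; ext y; congr 1; ring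
    · exact (hfi _).const_mul _
    · exact Filter.Eventually.of_forall fun y =>
        mul_nonneg (hw0 x) (mul_nonneg (sq_nonneg _) (hw0 y))
  simp_rw [e1]
  have i1 : Integrable (fun x => P * (u x^2 * w x) - 2*A*(u x * w x)) μ :=
    (huuw.const_mul P).sub (huw.const_mul (2*A))
  have i2 : Integrable (fun x => P * (u x^2 * w x) - 2*A*(u x * w x) + D * w x) μ :=
    i1.add (hw.const_mul D)
  have e2 : (fun x => w x * (u x^2 * P - 2*u x*A + D)) =
    fun x => P * (u x^2 * w x) - 2*A*(u x * w x) + D * w x := by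
    ext x; ring
  rw [← ofReal_integral_eq_lintegral_ofReal]
  · congr 1
    rw [e2, integral_add i1 (hw.const_mul D),
      integral_sub (huuw.const_mul P) (huw.const_mul (2*A)), integral_const_mul,
      integral_const_mul, integral_const_mul]
    have : ∀ x, |u x - A / P| ^ 2 * w x = (A/P - u x)^2 * w x := by
      intro x; rw [sq_abs]; ring
    simp_rw [this]
    rw [hfe]
    change 2 * P * _ = P * D - 2 * A * A + D * P
    field_simp
    ring
  · rw [e2]; exact i2
  · refine Filter.Eventually.of_forall fun x => mul_nonneg (hw0 x) ?_
    rw [← hfe]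
    exact integral_nonneg fun y => mul_nonneg (sq_nonneg _) (hw0 y)

theorem aux_core {N : ℕ} (x₀ : EuclideanSpace ℝ (Fin N)) (r : ℝ) (hr : 0 < r)
    (w u : EuclideanSpace ℝ (Fin N) → ℝ) (M : ℝ) (hwm : Measurable w)
    (hw0 : ∀ x, 0 ≤ w x) (hwM : ∀ x, w x ≤ M)
    (hq : ∀ x y : EuclideanSpace ℝ (Fin N), ∀ t : ℝ, 0 ≤ t → t ≤ 1 →
      min (w x) (w y) ≤ w ((1-t) • x + t • y))
    (hpos : 0 < ∫ x in Metric.ball x₀ r, w x)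
    (hu : ContDiffOn ℝ 1 u (Metric.ball x₀ r))
    (hi : IntegrableOn (fun x => (u x ^ 2 + ‖gradient u x‖ ^ 2) * w x) (Metric.ball x₀ r)) :
    2 * (∫ x in Metric.ball x₀ r, w x) * (∫ x in Metric.ball x₀ r,
      |u x - (∫ y in Metric.ball x₀ r, u y * w y) / (∫ y in Metric.ball x₀ r, w y)| ^ 2 * w x) ≤
    4 * r^2 * M * (2^N * volume.real (Metric.ball x₀ r) *
      ∫ x in Metric.ball x₀ r, ‖gradient u x‖ ^ 2 * w x) := by
  set B := Metric.ball x₀ r with hB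
  have hBm : MeasurableSet B := measurableSet_ball
  have hBf : volume B ≠ ⊤ := measure_ball_lt_top.ne
  have hM : 0 ≤ M := (hw0 x₀).trans (hwM x₀)
  have hgm : Measurable (fun x => ‖gradient u x‖) := by
    have : (fun x => ‖gradient u x‖) = fun x => ‖fderiv ℝ u x‖ := by
      ext p; simp [gradient]
    rw [this]
    exact (measurable_fderiv ℝ u).norm
  have hum : AEStronglyMeasurable u (volume.restrict B) :=
    hu.continuousOn.aestronglyMeasurable hBm
  have hwi : Integrable w (volume.restrict B) := by
    have : IsFiniteMeasure (volume.restrict B) := ⟨by simpa using hBf.lt_top⟩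
    exact Integrable.of_bound hwm.aestronglyMeasurable M
      (Filter.Eventually.of_forall fun x => by
        rw [Real.norm_eq_abs, abs_of_nonneg (hw0 x)]; exact hwM x)
  have huui : Integrable (fun x => u x ^ 2 * w x) (volume.restrict B) := by
    refine Integrable.mono' hi ((hum.pow 2).mul hwm.aestronglyMeasurable)
      (Filter.Eventually.of_forall fun x => ?_)
    rw [Real.norm_eq_abs, abs_of_nonneg (mul_nonneg (sq_nonneg _) (hw0 x))]
    exact mul_le_mul_of_nonneg_right (by nlinarith [sq_nonneg ‖gradient u x‖]) (hw0 x)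
  have hgi : Integrable (fun x => ‖gradient u x‖ ^ 2 * w x) (volume.restrict B) := by
    refine Integrable.mono' hi (((hgm.pow_const 2).mul hwm).aestronglyMeasurable)
      (Filter.Eventually.of_forall fun x => ?_)
    rw [Real.norm_eq_abs, abs_of_nonneg (mul_nonneg (sq_nonneg _) (hw0 x))]
    exact mul_le_mul_of_nonneg_right (by nlinarith [sq_nonneg (u x)]) (hw0 x)
  have hui : Integrable (fun x => u x * w x) (volume.restrict B) := by
    refine Integrable.mono' (huui.add hwi) (hum.mul hwm.aestronglyMeasurable)
      (Filter.Eventually.of_forall fun x => ?_)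
    rw [Real.norm_eq_abs, abs_mul, abs_of_nonneg (hw0 x)]
    simp only [Pi.add_apply]
    have : |u x| ≤ u x ^ 2 + 1 := by
      rw [← sq_abs]; nlinarith [sq_nonneg (|u x| - 1), abs_nonneg (u x)]
    nlinarith [mul_le_mul_of_nonneg_right this (hw0 x)]
  have hvar := aux_var (volume.restrict B) w u hwi hui huui hw0 hpos
  set H : EuclideanSpace ℝ (Fin N) → ℝ := fun x => ‖gradient u x‖ ^ 2 * w x with hH
  have hH0 : ∀ x, 0 ≤ H x := fun x => mul_nonneg (sq_nonneg _) (hw0 x)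
  have hHm : Measurable H := (hgm.pow_const 2).mul hwm
  set K : EuclideanSpace ℝ (Fin N) → ENNReal := B.indicator (fun x => ENNReal.ofReal (H x)) with hK
  have hKm : Measurable K := hHm.ennreal_ofReal.indicator hBm
  have hKint : ∫⁻ x, K x = ENNReal.ofReal (∫ x in B, H x) := by
    rw [hK, lintegral_indicator hBm, ofReal_integral_eq_lintegral_ofReal hgi
      (Filter.Eventually.of_forall hH0)]
  have hR : 0 ≤ 4 * r^2 * M := by positivity
  have hpt : ∀ x ∈ B, ∀ y ∈ B, ENNReal.ofReal ((u x - u y)^2 * (w x * w y)) ≤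
      ENNReal.ofReal (4 * r^2 * M) * ∫⁻ t in Set.Ioc (0:ℝ) 1, K ((1-t) • x + t • y) := by
    intro x hx y hy
    obtain ⟨hI, hle⟩ := aux_ftc x₀ r u hu x y hx hy
    have hI' : IntegrableOn (fun t : ℝ => ‖gradient u ((1-t) • x + t • y)‖^2)
      (Set.Ioc (0:ℝ) 1) := (intervalIntegrable_iff_integrableOn_Ioc_of_le zero_le_one).1 hI
    rw [intervalIntegral.integral_of_le zero_le_one] at hle
    set J := ∫ t in Set.Ioc (0:ℝ) 1, ‖gradient u ((1-t) • x + t • y)‖^2 with hJ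
    have hJ0 : 0 ≤ J := integral_nonneg fun t => sq_nonneg _
    have hdist : ‖y - x‖ ^ 2 ≤ 4 * r^2 := by
      have h1 : ‖y - x‖ ≤ 2 * r := by
        rw [← dist_eq_norm]
        have := dist_triangle_right y x x₀
        have h2 := Metric.mem_ball.1 hx
        have h3 := Metric.mem_ball.1 hy
        linarith
      nlinarith [norm_nonneg (y - x)]
    have hm0 : 0 ≤ min (w x) (w y) := le_min (hw0 x) (hw0 y)
    have hmm : w x * w y ≤ M * min (w x) (w y) := by
      rw [← max_mul_min]
      exact mul_le_mul_of_nonneg_right (max_le (hwM x) (hwM y)) hm0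
    have s1 : (u x - u y)^2 * (w x * w y) ≤ 4 * r^2 * M * (J * min (w x) (w y)) := by
      calc (u x - u y)^2 * (w x * w y) ≤ (4 * r^2 * J) * (M * min (w x) (w y)) := by
            refine mul_le_mul (hle.trans (mul_le_mul_of_nonneg_right hdist hJ0)) hmm
              (mul_nonneg (hw0 x) (hw0 y)) (by positivity)
        _ = _ := by ring
    refine (ENNReal.ofReal_le_ofReal s1).trans ?_
    rw [ENNReal.ofReal_mul hR]
    gcongr
    rw [hJ, ← integral_mul_const, ofReal_integral_eq_lintegral_ofReal (hI'.mul_const _)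
      (Filter.Eventually.of_forall fun t => mul_nonneg (sq_nonneg _) hm0)]
    refine setLIntegral_mono' measurableSet_Ioc fun t ht => ?_
    have hz : (1-t) • x + t • y ∈ B :=
      (convex_ball x₀ r) hx hy (by linarith [ht.2]) ht.1.le (by ring)
    rw [hK, Set.indicator_of_mem hz]
    exact ENNReal.ofReal_le_ofReal
      (mul_le_mul_of_nonneg_left (hq x y t ht.1.le ht.2) (sq_nonneg _))
  have hfin : ∫⁻ x in B, ∫⁻ y in B, ENNReal.ofReal ((u x - u y)^2 * (w x * w y)) ≤
      ENNReal.ofReal (4 * r^2 * M) * (2^N * volume B * ∫⁻ x, K x) := by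
    calc _ ≤ ∫⁻ x in B, ∫⁻ y in B, ENNReal.ofReal (4 * r^2 * M) *
          ∫⁻ t in Set.Ioc (0:ℝ) 1, K ((1-t) • x + t • y) :=
          setLIntegral_mono' hBm fun x hx => setLIntegral_mono' hBm fun y hy => hpt x hx y hy
      _ = ENNReal.ofReal (4 * r^2 * M) * ∫⁻ x in B, ∫⁻ y in B,
          ∫⁻ t in Set.Ioc (0:ℝ) 1, K ((1-t) • x + t • y) := by
          simp_rw [lintegral_const_mul' _ _ ENNReal.ofReal_ne_top]
      _ ≤ _ := by gcongr; exact aux_double K hKm B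
  have hI0 : 0 ≤ ∫ x in B, H x := integral_nonneg hH0
  have hrhs : ENNReal.ofReal (4 * r^2 * M) * (2^N * volume B * ∫⁻ x, K x) =
      ENNReal.ofReal (4 * r^2 * M * (2^N * volume.real B * ∫ x in B, H x)) := by
    rw [hKint, ENNReal.ofReal_mul (p := 4 * r^2 * M) hR,
      ENNReal.ofReal_mul (p := 2^N * volume.real B) (by positivity),
      ENNReal.ofReal_mul (p := 2^N) (by positivity), ENNReal.ofReal_pow (by norm_num),
      ofReal_measureReal hBf]
    simp
  rw [← hvar, hrhs] at hfin
  exact (ENNReal.ofReal_le_ofReal_iff (by positivity)).1 hfin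

theorem stmt_4 (N : ℕ) (hN : 2 ≤ N) (g : ℝ → ℝ)
    (hg_anti : AntitoneOn g (Set.Ici 0)) (hg_nonneg : ∀ t, 0 ≤ t → 0 ≤ g t)
    (hg_bdd : ∃ M : ℝ, ∀ t, 0 ≤ t → g t ≤ M) :
    ∃ C : ℝ, 0 < C ∧
      ∀ (x₀ : EuclideanSpace ℝ (Fin N)) (r : ℝ), 0 < r →
        (0 < ∫ x in Metric.ball x₀ r, g (‖x - x₀‖ / r)) →
        ∀ u : EuclideanSpace ℝ (Fin N) → ℝ,
          ContDiffOn ℝ 1 u (Metric.ball x₀ r) →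
          IntegrableOn (fun x => (u x ^ 2 + ‖gradient u x‖ ^ 2) * g (‖x - x₀‖ / r))
            (Metric.ball x₀ r) →
          (∫ x in Metric.ball x₀ r,
              |u x - (∫ y in Metric.ball x₀ r, u y * g (‖y - x₀‖ / r)) /
                  (∫ y in Metric.ball x₀ r, g (‖y - x₀‖ / r))| ^ 2 * g (‖x - x₀‖ / r)) ≤
            C * r ^ 2 * ∫ x in Metric.ball x₀ r, ‖gradient u x‖ ^ 2 * g (‖x - x₀‖ / r) := by
  obtain ⟨M, hM⟩ := hg_bdd
  set I := ∫ x in Metric.ball (0 : EuclideanSpace ℝ (Fin N)) 1, g ‖x‖ with hI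
  have hM0 : 0 ≤ M := (hg_nonneg 0 le_rfl).trans (hM 0 le_rfl)
  have hI0 : 0 ≤ I := integral_nonneg fun x => hg_nonneg _ (norm_nonneg _)
  set V := volume.real (Metric.ball (0 : EuclideanSpace ℝ (Fin N)) 1) with hV
  have hC0 : 0 ≤ 2 * M * 2^N * V / I := by positivity
  refine ⟨2 * M * 2^N * V / I + 1, by linarith, ?_⟩
  intro x₀ r hr hpos u hu hi
  have hscale : ∫ x in Metric.ball x₀ r, g (‖x - x₀‖ / r) = r^N * I := by
    have h1 : ∫ x in Metric.ball x₀ r, g (‖x - x₀‖ / r) =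
        ∫ x, (Metric.ball (0 : EuclideanSpace ℝ (Fin N)) 1).indicator (fun x => g ‖x‖)
          (r⁻¹ • (x - x₀)) := by
      rw [← integral_indicator measurableSet_ball]
      congr 1; ext x
      have hn : ‖r⁻¹ • (x - x₀)‖ = ‖x - x₀‖ / r := by
        rw [norm_smul, norm_inv, Real.norm_eq_abs, abs_of_pos hr]; ring
      have hmem : x ∈ Metric.ball x₀ r ↔
          r⁻¹ • (x - x₀) ∈ Metric.ball (0 : EuclideanSpace ℝ (Fin N)) 1 := by
        rw [mem_ball_zero_iff, hn, div_lt_one hr, mem_ball_iff_norm]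
      by_cases hx : x ∈ Metric.ball x₀ r
      · rw [Set.indicator_of_mem hx, Set.indicator_of_mem (hmem.1 hx), hn]
      · rw [Set.indicator_of_notMem hx, Set.indicator_of_notMem (fun h => hx (hmem.2 h))]
    rw [h1, integral_sub_right_eq_self (fun x =>
      (Metric.ball (0 : EuclideanSpace ℝ (Fin N)) 1).indicator (fun x => g ‖x‖) (r⁻¹ • x)) x₀,
      Measure.integral_comp_smul, integral_indicator measurableSet_ball]
    simp only [finrank_euclideanSpace, Fintype.card_fin, smul_eq_mul]
    rw [inv_pow, inv_inv, abs_of_nonneg (by positivity)]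
  have hvol : volume.real (Metric.ball x₀ r) = r^N * V := by
    rw [hV, Measure.real, Measure.real, Measure.addHaar_ball_of_pos _ _ hr, ENNReal.toReal_mul,
      ENNReal.toReal_ofReal (by positivity)]
    simp
  have hIpos : 0 < I := by
    rw [hscale] at hpos
    exact pos_of_mul_pos_right hpos (by positivity)
  have hwm : Measurable (fun x : EuclideanSpace ℝ (Fin N) => g (‖x - x₀‖ / r)) := by
    have ha : Antitone (fun t : ℝ => g (max t 0)) := fun a b hab =>
      hg_anti (Set.mem_Ici.2 (le_max_right _ _)) (Set.mem_Ici.2 (le_max_right _ _)) (max_le_max hab le_rfl)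
    have : (fun x : EuclideanSpace ℝ (Fin N) => g (‖x - x₀‖ / r)) =
        (fun t : ℝ => g (max t 0)) ∘ fun x => ‖x - x₀‖ / r := by
      ext x
      simp only [Function.comp]
      rw [max_eq_left (by positivity)]
    rw [this]
    exact ha.measurable.comp (by fun_prop)
  have key := aux_core x₀ r hr (fun x => g (‖x - x₀‖ / r)) u M hwm
    (fun x => hg_nonneg _ (by positivity)) (fun x => hM _ (by positivity))
    (by
      intro x y t ht0 ht1
      have hle : ‖(1-t) • x + t • y - x₀‖ ≤ max ‖x - x₀‖ ‖y - x₀‖ := by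
        have e : (1-t) • x + t • y - x₀ = (1-t) • (x - x₀) + t • (y - x₀) := by module
        rw [e]
        refine (norm_add_le _ _).trans ?_
        rw [norm_smul, norm_smul, Real.norm_eq_abs, Real.norm_eq_abs, abs_of_nonneg ht0,
          abs_of_nonneg (by linarith : 0 ≤ 1 - t)]
        nlinarith [le_max_left ‖x - x₀‖ ‖y - x₀‖, le_max_right ‖x - x₀‖ ‖y - x₀‖]
      rcases le_max_iff.1 hle with h | h
      · refine (min_le_left _ _).trans (hg_anti ?_ ?_ ?_)
        · exact Set.mem_Ici.2 (by positivity)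
        · exact Set.mem_Ici.2 (by positivity)
        · gcongr
      · refine (min_le_right _ _).trans (hg_anti ?_ ?_ ?_)
        · exact Set.mem_Ici.2 (by positivity)
        · exact Set.mem_Ici.2 (by positivity)
        · gcongr)
    hpos hu hi
  have hG0 : 0 ≤ ∫ x in Metric.ball x₀ r, ‖gradient u x‖ ^ 2 * g (‖x - x₀‖ / r) :=
    integral_nonneg fun x => mul_nonneg (sq_nonneg _) (hg_nonneg _ (by positivity))
  simp only [] at key
  set L := ∫ x in Metric.ball x₀ r,
              |u x - (∫ y in Metric.ball x₀ r, u y * g (‖y - x₀‖ / r)) /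
                  (∫ y in Metric.ball x₀ r, g (‖y - x₀‖ / r))| ^ 2 * g (‖x - x₀‖ / r) with hL
  set G := ∫ x in Metric.ball x₀ r, ‖gradient u x‖ ^ 2 * g (‖x - x₀‖ / r) with hG
  rw [hvol, hscale] at key
  have hrN : 0 < r^N := by positivity
  have h3 : L ≤ 2 * M * 2^N * V / I * r^2 * G := by
    have h4 : (2 * r^N) * (I * L) ≤ (2 * r^N) * (2 * M * 2^N * V * r^2 * G) := by
      linarith
    have h5 := le_of_mul_le_mul_left h4 (by positivity)
    rw [div_mul_eq_mul_div, div_mul_eq_mul_div, le_div_iff₀ hIpos]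
    linarith
  have : 0 ≤ r^2 * G := by positivity
  nlinarith
end
end
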